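/- Fix for every k ≥ 0 a 2^k-connector H_k, and let {G_n} be the recursively constructed family of DAGs with base lists Base(G_n) of length 2^n (construction in context). Then for every n, the graph G_{n+1} is (2^n, 2^n)-depth-robust with respect to Base(RS(G_{n+1})), the base list of its right component. -/

import Mathlib

/-- A family of graphs, where the `k`-th member is intended to be a `2^k`-connector:
a finite DAG with `2^k` distinguished inputs and `2^k` distinguished outputs. -/
structure ConnFam where
  V : ℕ → Type
  fin : ∀ k, Fintype (V k)
  E : ∀ k, V k → V k → Prop
  inp : ∀ k, Fin (2 ^ k) → V k
  out : ∀ k, Fin (2 ^ k) → V k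

/-- The `k`-th member is a `2^k`-connector: inputs and outputs are distinguished
(injective lists), the graph is acyclic, and for every `1 ≤ j ≤ 2^k` and every `j`
distinct inputs and `j` distinct outputs there are `j` pairwise vertex-disjoint
directed paths connecting them in order. -/
def IsConnectorFam (F : ConnFam) : Prop :=
  (∀ k, Function.Injective (F.inp k)) ∧
  (∀ k, Function.Injective (F.out k)) ∧
  (∀ k (v : F.V k), ¬ Relation.TransGen (F.E k) v v) ∧
  (∀ k (j : ℕ), 1 ≤ j → j ≤ 2 ^ k → ∀ s t : Fin j → Fin (2 ^ k),
    Function.Injective s → Function.Injective t →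
    ∃ P : Fin j → List (F.V k),
      (∀ i, (P i).Chain' (F.E k) ∧ (P i).head? = some (F.inp k (s i)) ∧
        (P i).getLast? = some (F.out k (t i))) ∧
      ∀ i i', i ≠ i' → ∀ v ∈ P i, v ∉ P i')

/-- The data of the recursive construction at level `n`:
`GV` is the vertex set of the plain graph `G_n`, `AV` is the set of fresh vertices added
by the augmentation `X ▷ G_n` (the connector copies introduced by the `▷` operator for an
external list `X` of length `2^n`), `EG` is the edge relation of `G_n`, `E` is the edge
relation of `G_n` together with all the edges of `X ▷ G_n` that do not start in `X`,
`base` is the list `Base(G_n)` (of length `2^n`), and `tgt i` is the endpoint inside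
`G_n ∪ A_n` of the edge leaving the `i`-th element of `X` in `X ▷ G_n`. -/
structure Blob (n : ℕ) where
  GV : Type
  AV : Type
  EG : GV → GV → Prop
  E : (GV ⊕ AV) → (GV ⊕ AV) → Prop
  base : Fin (2 ^ n) → GV
  tgt : Fin (2 ^ n) → GV ⊕ AV

/-- Level `0` of the construction: `G_0` is a single node `v`, `Base(G_0) = ⟨v⟩`,
and `X ▷ G_0 = X → Base(G_0)` adds no fresh vertices. -/
def blobZero : Blob 0 where
  GV := Unit
  AV := Empty
  EG := fun _ _ => False
  E := fun _ _ => False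
  base := fun _ => ()
  tgt := fun _ => Sum.inl ()

/-- The recursive step of the construction, building `G_{n+1}` (and its
`▷`-augmentation data) from `G_n` and the connector `H_n = F n`:
`G_{n+1}` consists of a left component `L ≅ G_n`, a connector component `C ≅ H_n` and a
right component `R ≅ G_n` (carried together with its own augmentation vertices), with
`Base(G_{n+1}) = Base(L) : Base(R)`, and edge set
`E(L) ∪ E(C) ∪ E(R) ∪ (Base(L) → In(C)) ∪ E(Out(C) ▷ R)`, where
`(X₁ : X₂) ▷ Y = (X₁ ▷ LS(Y)) ∪ (X₂ →^H In(CS(Y)))` and `I →^H O` attaches a fresh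
copy of the connector `H` between `I` and `O`; the augmentation of `G_{n+1}` accordingly
consists of the augmentation of its left component plus one fresh copy of `H_n`. -/
def blobSucc (F : ConnFam) (n : ℕ) (b : Blob n) : Blob (n + 1) :=
  let GV' := b.GV ⊕ (F.V n ⊕ (b.GV ⊕ b.AV))
  let AV' := b.AV ⊕ F.V n
  let e₁ : b.GV ⊕ b.AV → GV' ⊕ AV' := fun x =>
    match x with
    | Sum.inl g => Sum.inl (Sum.inl g)
    | Sum.inr a => Sum.inr (Sum.inl a)
  let EG' : GV' → GV' → Prop := fun x y =>
    match x, y with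
    | Sum.inl a, Sum.inl a' => b.EG a a'
    | Sum.inr (Sum.inl c), Sum.inr (Sum.inl c') => F.E n c c'
    | Sum.inr (Sum.inr u), Sum.inr (Sum.inr u') => b.E u u'
    | Sum.inl a, Sum.inr (Sum.inl c) => ∃ i, a = b.base i ∧ c = F.inp n i
    | Sum.inr (Sum.inl c), Sum.inr (Sum.inr u) => ∃ i, c = F.out n i ∧ u = b.tgt i
    | _, _ => False
  { GV := GV'
    AV := AV'
    EG := EG'
    E := fun x y =>
      (∃ gx gy, x = Sum.inl gx ∧ y = Sum.inl gy ∧ EG' gx gy) ∨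
      (∃ u v, x = e₁ u ∧ y = e₁ v ∧ b.E u v) ∨
      (∃ c c', x = Sum.inr (Sum.inr c) ∧ y = Sum.inr (Sum.inr c') ∧ F.E n c c') ∨
      (∃ i, x = Sum.inr (Sum.inr (F.out n i)) ∧
        y = Sum.inl (Sum.inr (Sum.inl (F.inp n i))))
    base := fun i =>
      if h : (i : ℕ) < 2 ^ n then Sum.inl (b.base ⟨i, h⟩)
      else Sum.inr (Sum.inr (Sum.inl (b.base ⟨(i : ℕ) - 2 ^ n, by
        have hi := i.isLt
        have key : (2 : ℕ) ^ (n + 1) = 2 ^ n * 2 := pow_succ 2 n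
        omega⟩)))
    tgt := fun i =>
      if h : (i : ℕ) < 2 ^ n then e₁ (b.tgt ⟨i, h⟩)
      else Sum.inr (Sum.inr (F.inp n ⟨(i : ℕ) - 2 ^ n, by
        have hi := i.isLt
        have key : (2 : ℕ) ^ (n + 1) = 2 ^ n * 2 := pow_succ 2 n
        omega⟩)) }

/-- The recursively constructed family `{G_n}` (with augmentation data). -/
def blob (F : ConnFam) : (n : ℕ) → Blob n
  | 0 => blobZero
  | n + 1 => blobSucc F n (blob F n)

/-- There is a directed path (w.r.t. `E`) of length at least `γ` (i.e. with at least
`γ + 1` vertices) ending in `v`, all of whose vertices lie in `A`. -/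
def LongPathEndingGe {V : Type*} (E : V → V → Prop) (A : Set V) (v : V) (γ : ℕ) : Prop :=
  ∃ l : List V, l.Chain' E ∧ (∀ x ∈ l, x ∈ A) ∧ l.getLast? = some v ∧ γ < l.length

/-- `G = (V, E)` is `(μ, γ)`-depth-robust w.r.t. `O ⊆ V` (with `|O| = μ`): for every
finite `R ⊆ V` with `|R| < μ` there is `O' ⊆ O` with `|O'| ≥ μ − |R|` such that every
`v ∈ O'` satisfies `llp(v, G \ R) ≥ γ`. -/
def DepthRobustSet {V : Type*} (E : V → V → Prop) (O : Set V) (μ γ : ℕ) : Prop :=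
  O.ncard = μ ∧ ∀ R : Set V, R.Finite → R.ncard < μ →
    ∃ O' ⊆ O, μ - R.ncard ≤ O'.ncard ∧ ∀ v ∈ O', LongPathEndingGe E {x | x ∉ R} v γ

open Classical in
noncomputable def cnt {m : ℕ} (q : Fin m → Prop) : ℕ := (Finset.univ.filter q).card

lemma cnt_mono {m : ℕ} {q r : Fin m → Prop} (h : ∀ i, q i → r i) : cnt q ≤ cnt r := by
  classical
  unfold cnt
  apply Finset.card_le_card
  intro i
  simpa using h i

lemma cnt_le {m : ℕ} (q : Fin m → Prop) : cnt q ≤ m := by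
  classical
  unfold cnt
  exact (Finset.card_le_univ _).trans (by simp)

lemma cnt_mem {m : ℕ} (A : Finset (Fin m)) : cnt (fun i => i ∈ A) = A.card := by
  classical
  unfold cnt
  congr 1
  ext i
  simp

/-- Pigeonhole: two predicates that are together large have a common witness. -/
lemma cnt_inter {m : ℕ} {q : Fin m → Prop} {A : Finset (Fin m)} (h : m < cnt q + A.card) :
    ∃ i, q i ∧ i ∈ A := by
  classical
  by_contra hc
  push Not at hc
  have hd : Disjoint (Finset.univ.filter q) A := by
    rw [Finset.disjoint_left]
    intro i hi
    exact hc i (by simpa using hi)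
  have h1 := Finset.card_union_of_disjoint hd
  have h2 := Finset.card_le_univ ((Finset.univ.filter q) ∪ A)
  have h3 : cnt q = (Finset.univ.filter q).card := by
    unfold cnt
    congr
  simp only [Fintype.card_fin] at h2
  omega

lemma cnt_split {M N : ℕ} (h : M = N + N) (q : Fin M → Prop) :
    cnt q = cnt (fun i : Fin N => q ⟨i, by omega⟩) +
      cnt (fun i : Fin N => q ⟨N + i, by omega⟩) := by
  classical
  subst h
  unfold cnt
  simp only [Finset.card_filter]
  rw [Fin.sum_univ_add]
  congr 1

def Closed {V : Type*} (E : V → V → Prop) (S : Finset V) (P : V → ℕ → Prop) : Prop :=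
  (∀ v d, P v (d + 1) → P v d) ∧ ∀ v w d, P v d → E v w → w ∉ S → P w (d + 1)

lemma Closed.down {V : Type*} {E : V → V → Prop} {S : Finset V} {P : V → ℕ → Prop}
    (h : Closed E S P) {v : V} {d e : ℕ} (hde : d ≤ e) (hP : P v e) : P v d := by
  induction hde with
  | refl => exact hP
  | step _ ih => exact ih (h.1 _ _ hP)

def Reach {V : Type*} (E : V → V → Prop) (S : Finset V) (a b : V) : Prop :=
  a ∉ S ∧ Relation.ReflTransGen (fun x y => E x y ∧ y ∉ S) a b

lemma Closed.reach {V : Type*} {E : V → V → Prop} {S : Finset V} {P : V → ℕ → Prop}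
    (h : Closed E S P) {a b : V} (hr : Reach E S a b) {d : ℕ} (hP : P a d) : P b d := by
  obtain ⟨-, hr⟩ := hr
  induction hr with
  | refl => exact hP
  | tail _ hs ih => exact h.1 _ _ (h.2 _ _ _ ih hs.1 hs.2)

lemma reach_of_list {V : Type*} {E : V → V → Prop} {S : Finset V} (l : List V) :
    ∀ {a b : V}, l.Chain' E → l.head? = some a → l.getLast? = some b →
    (∀ v ∈ l, v ∉ S) → Reach E S a b := by
  induction l with
  | nil => intro a b _ h; simp at h
  | cons x l ih =>
    intro a b hc ha hb hS
    have hxa : x = a := by simpa using ha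
    subst hxa
    cases l with
    | nil =>
      have : x = b := by simpa using hb
      subst this
      exact ⟨hS _ (by simp), Relation.ReflTransGen.refl⟩
    | cons y l =>
      have hc' := List.isChain_cons_cons.1 hc
      have := ih (a := y) (b := b) hc'.2 rfl (by simpa using hb)
        (fun v hv => hS v (List.mem_cons_of_mem _ hv))
      exact ⟨hS _ (by simp), Relation.ReflTransGen.head ⟨hc'.1, this.1⟩ this.2⟩

/-- Removing `S` from a connector amounts to removing some inputs and outputs, at most `|S|`
in total: all remaining inputs reach all remaining outputs. -/
lemma conn (F : ConnFam) (hF : IsConnectorFam F) (k : ℕ) (S : Finset (F.V k)) :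
    ∃ A T : Finset (Fin (2 ^ k)), 2 ^ k + 2 ^ k ≤ A.card + T.card + S.card ∧
      ∀ i ∈ A, ∀ o ∈ T, Reach (F.E k) S (F.inp k i) (F.out k o) := by
  classical
  obtain ⟨-, -, -, hP⟩ := hF
  by_cases hS : 2 ^ k ≤ S.card
  · exact ⟨∅, Finset.univ, by simp; omega, by simp⟩
  push Not at hS
  obtain ⟨m, hm⟩ : ∃ m, 2 ^ k = S.card + 1 + m := ⟨2 ^ k - (S.card + 1), by omega⟩
  let bad : Fin (2 ^ k) → Finset (Fin (2 ^ k)) := fun i =>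
    Finset.univ.filter fun o => ¬ Reach (F.E k) S (F.inp k i) (F.out k o)
  by_contra hcon
  push Not at hcon
  have hall : ∀ A : Finset (Fin (2 ^ k)), A.card ≤ (A.biUnion bad).card + m := by
    intro A
    by_contra hlt
    obtain ⟨i, hi, o, ho, hio⟩ := hcon A (Finset.univ \ A.biUnion bad) (by
      have h1 := Finset.card_sdiff_add_card_eq_card (Finset.subset_univ (A.biUnion bad))
      simp only [Finset.card_univ, Fintype.card_fin] at h1
      omega)
    simp only [Finset.mem_sdiff, Finset.mem_univ, true_and, Finset.mem_biUnion, not_exists,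
      not_and] at ho
    exact ho i hi (by simp [bad, hio])
  let bad' : Fin (2 ^ k) → Finset (Fin (2 ^ k) ⊕ Fin m) := fun i =>
    (bad i).disjSum Finset.univ
  obtain ⟨f, hfi, hf⟩ := (Finset.all_card_le_biUnion_card_iff_exists_injective bad').1 (by
    intro A
    rcases A.eq_empty_or_nonempty with rfl | hA
    · simp
    have : (A.biUnion bad).disjSum (Finset.univ : Finset (Fin m)) ⊆ A.biUnion bad' := by
      intro x hx
      rcases x with x | x
      · simpa [bad'] using hx
      · simpa [bad', Finset.Nonempty] using hA
    have h2 := Finset.card_le_card this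
    rw [Finset.card_disjSum] at h2
    have := hall A
    simp only [Finset.card_univ, Fintype.card_fin] at h2
    omega)
  -- the inputs matched to genuine outputs
  let W : Finset (Fin (2 ^ k)) := Finset.univ.filter fun i => (f i).isLeft
  have hW : S.card + 1 ≤ W.card := by
    have h1 := Finset.card_filter_add_card_filter_not (s := (Finset.univ : Finset (Fin (2 ^ k))))
      (fun i => ((f i).isLeft : Prop))
    have h2 : (Finset.univ.filter fun i => ¬ ((f i).isLeft : Prop)).card ≤ m := by
      have : (Finset.univ.filter fun i => ¬ ((f i).isLeft : Prop)).image f ⊆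
          (Finset.univ : Finset (Fin m)).image Sum.inr := by
        intro x hx
        simp only [Finset.mem_image, Finset.mem_filter, Finset.mem_univ, true_and] at hx ⊢
        obtain ⟨i, hi, rfl⟩ := hx
        cases hfi : f i with
        | inl y => simp [hfi] at hi
        | inr y => exact ⟨y, rfl⟩
      have h3 := Finset.card_le_card this
      rw [Finset.card_image_of_injective _ hfi, Finset.card_image_of_injective _
        Sum.inr_injective] at h3
      simpa using h3
    simp only [Finset.card_univ, Fintype.card_fin] at h1
    change _ ≤ (Finset.univ.filter fun i => ((f i).isLeft : Prop)).card
    omega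
  obtain ⟨W', hW'W, hW'⟩ := Finset.exists_subset_card_eq hW
  let s : Fin (S.card + 1) → Fin (2 ^ k) := fun i => W'.orderEmbOfFin hW' i
  have hs : Function.Injective s := (W'.orderEmbOfFin hW').injective
  have hsW : ∀ i, ∃ o, f (s i) = Sum.inl o := by
    intro i
    have := hW'W (W'.orderEmbOfFin_mem hW' i)
    simp only [W, Finset.mem_filter, Finset.mem_univ, true_and] at this
    exact Sum.isLeft_iff.1 this
  choose t ht using hsW
  have htinj : Function.Injective t := by
    intro i j hij
    apply hs
    apply hfi
    rw [ht, ht, hij]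
  obtain ⟨P, hP1, hP2⟩ := hP k (S.card + 1) (by omega) (by omega) s t hs htinj
  have hcut : ∀ i, ∃ v ∈ P i, v ∈ S := by
    intro i
    by_contra hno
    push Not at hno
    have hr := reach_of_list (P i) (hP1 i).1 (hP1 i).2.1 (hP1 i).2.2 hno
    have := hf (s i)
    rw [ht] at this
    simp only [bad', bad, Finset.inl_mem_disjSum, Finset.mem_filter, Finset.mem_univ,
      true_and] at this
    exact this hr
  choose v hv hvS using hcut
  have hvinj : Function.Injective v := by
    intro i j hij
    by_contra hne
    exact hP2 i j hne (v i) (hv i) (hij ▸ hv j)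
  have hle := Finset.card_le_card_of_injOn (s := Finset.univ) (t := S) v
    (fun i _ => hvS i) hvinj.injOn
  simp at hle

def QProp {n : ℕ} (b : Blob n) : Prop :=
  ∀ (S : Finset (b.GV ⊕ b.AV)) (P : b.GV ⊕ b.AV → ℕ → Prop), Closed b.E S P →
    ∀ (c : ℕ) (X : Fin (2 ^ n) → Prop), (∀ j, X j → b.tgt j ∉ S → P (b.tgt j) c) →
    ∀ g, cnt X ≤ cnt (fun i => P (Sum.inl (b.base i)) (c + g)) + S.card + g

def BProp {n : ℕ} (b : Blob n) : Prop :=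
  ∀ (S : Finset b.GV) (P : b.GV → ℕ → Prop), Closed b.EG S P → (∀ v, v ∉ S → P v 0) →
    ∀ g, 2 ^ n ≤ cnt (fun i => P (b.base i) g) + S.card + g

lemma core (F : ConnFam) (hF : IsConnectorFam F) {n : ℕ} (b : Blob n) (hQ : QProp b)
    (S : Finset (b.GV ⊕ (F.V n ⊕ (b.GV ⊕ b.AV))))
    (P : b.GV ⊕ (F.V n ⊕ (b.GV ⊕ b.AV)) → ℕ → Prop)
    (hc : Closed (blobSucc F n b).EG S P) :
    ∃ p q : ℕ, p + q ≤ S.toRight.toLeft.card ∧ p ≤ 2 ^ n ∧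
      ∀ c, p < cnt (fun i => Sum.inr (Sum.inl (F.inp n i)) ∉ S →
          P (Sum.inr (Sum.inl (F.inp n i))) c) →
        ∀ g, 2 ^ n ≤ cnt (fun i => P (Sum.inr (Sum.inr (Sum.inl (b.base i)))) (c + g)) +
          q + S.toRight.toRight.card + g := by
  obtain ⟨A, T, hcard, hAT⟩ := conn F hF n S.toRight.toLeft
  have hA : A.card ≤ 2 ^ n := (Finset.card_le_univ _).trans (by simp)
  have hT : T.card ≤ 2 ^ n := (Finset.card_le_univ _).trans (by simp)
  refine ⟨2 ^ n - A.card, 2 ^ n - T.card, by omega, by omega, ?_⟩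
  intro c hlt g
  obtain ⟨i, hi, hiA⟩ := cnt_inter (A := A) (q := fun i => Sum.inr (Sum.inl (F.inp n i)) ∉ S →
          P (Sum.inr (Sum.inl (F.inp n i))) c) (by omega)
  have hcC : Closed (F.E n) S.toRight.toLeft (fun v => P (Sum.inr (Sum.inl v))) := by
    refine ⟨fun v d h => hc.1 _ _ h, fun v w d h he hw => hc.2 _ _ _ h he ?_⟩
    exact fun h' => hw (Finset.mem_toLeft.2 (Finset.mem_toRight.2 h'))
  have hcR : Closed b.E S.toRight.toRight (fun v => P (Sum.inr (Sum.inr v))) := by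
    refine ⟨fun v d h => hc.1 _ _ h, fun v w d h he hw => hc.2 _ _ _ h he ?_⟩
    exact fun h' => hw (Finset.mem_toRight.2 (Finset.mem_toRight.2 h'))
  have h := hQ _ _ hcR (c + 1) (fun o => o ∈ T) (by
    intro o ho hS
    have hr := hAT i hiA o ho
    have h1 := hi (fun h' => hr.1 (Finset.mem_toLeft.2 (Finset.mem_toRight.2 h')))
    have h2 : P (Sum.inr (Sum.inl (F.out n o))) c := hcC.reach hr h1
    refine hc.2 _ _ _ h2 ⟨o, rfl, rfl⟩ ?_
    exact fun h' => hS (Finset.mem_toRight.2 (Finset.mem_toRight.2 h'))) g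
  rw [cnt_mem] at h
  have h' := cnt_mono (q := fun i => P (Sum.inr (Sum.inr (Sum.inl (b.base i)))) (c + 1 + g))
    (r := fun i => P (Sum.inr (Sum.inr (Sum.inl (b.base i)))) (c + g))
    (fun i hi => hc.down (by omega) hi)
  omega

lemma two_pow_split (n : ℕ) : 2 ^ (n + 1) = 2 ^ n + 2 ^ n := by ring

lemma base_left (F : ConnFam) {n : ℕ} (b : Blob n) (i : Fin (2 ^ n)) (h) :
    (blobSucc F n b).base ⟨i, h⟩ = Sum.inl (b.base i) := by
  simp [blobSucc]

lemma base_right (F : ConnFam) {n : ℕ} (b : Blob n) (i : Fin (2 ^ n)) (h) :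
    (blobSucc F n b).base ⟨2 ^ n + i, h⟩ = Sum.inr (Sum.inr (Sum.inl (b.base i))) := by
  simp [blobSucc]

def emb (F : ConnFam) {n : ℕ} (b : Blob n) :
    b.GV ⊕ b.AV → (b.GV ⊕ (F.V n ⊕ (b.GV ⊕ b.AV))) ⊕ (b.AV ⊕ F.V n)
  | Sum.inl g => Sum.inl (Sum.inl g)
  | Sum.inr a => Sum.inr (Sum.inl a)

lemma tgt_left (F : ConnFam) {n : ℕ} (b : Blob n) (i : Fin (2 ^ n)) (h) :
    (blobSucc F n b).tgt ⟨i, h⟩ = emb F b (b.tgt i) := by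
  simp only [blobSucc, i.isLt, dite_true]
  cases b.tgt i <;> rfl

lemma tgt_right (F : ConnFam) {n : ℕ} (b : Blob n) (i : Fin (2 ^ n)) (h) :
    (blobSucc F n b).tgt ⟨2 ^ n + i, h⟩ = Sum.inr (Sum.inr (F.inp n i)) := by
  simp [blobSucc]

/-- Numerical heart of both inductions. -/
lemma combine {fL fR : ℕ → ℕ} {k1 K N sL sC sR p q s : ℕ}
    (hpq : p + q ≤ sC) (hs : sL + sC + sR ≤ s) (hK : K ≤ k1 + N)
    (hmono : ∀ d e, d ≤ e → fR e ≤ fR d)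
    (h1 : ∀ d, k1 ≤ fL d + sL + d)
    (h2 : ∀ d, p < fL d → ∀ g, N ≤ fR (d + 1 + g) + q + sR + g)
    (h3 : k1 ≤ sL + p → ∀ d, K ≤ fL d + fR d + s + d) (d : ℕ) :
    K ≤ fL d + fR d + s + d := by
  by_cases hk : k1 ≤ sL + p
  · have := h3 hk d
    omega
  push Not at hk
  have h0 := h1 (k1 - sL - p - 1)
  have h4 := h2 (k1 - sL - p - 1) (by omega)
  by_cases hd : d ≤ k1 - sL - p
  · have := h4 0
    have h5 := hmono d (k1 - sL - p - 1 + 1 + 0) (by omega)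
    have := h1 d
    omega
  · have := h4 (d - (k1 - sL - p))
    have h5 := hmono d (k1 - sL - p - 1 + 1 + (d - (k1 - sL - p))) (by omega)
    omega

lemma card3 {α β γ : Type*} (S : Finset (α ⊕ (β ⊕ γ))) :
    S.toLeft.card + S.toRight.toLeft.card + S.toRight.toRight.card = S.card := by
  have h1 := S.card_toLeft_add_card_toRight
  have h2 := S.toRight.card_toLeft_add_card_toRight
  omega

lemma EG_E (F : ConnFam) (n : ℕ) {x y : (blob F n).GV} (h : (blob F n).EG x y) :
    (blob F n).E (Sum.inl x) (Sum.inl y) := by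
  cases n with
  | zero => exact h
  | succ n => exact Or.inl ⟨x, y, rfl, rfl, h⟩

lemma Q_zero : QProp blobZero := by
  intro S P hc c X hX g
  have h1 : cnt X ≤ 1 := cnt_le X
  by_cases h0 : X 0
  · by_cases hS : S.card = 0
    · rcases Nat.eq_zero_or_pos g with rfl | hg
      · have hP := hX 0 h0 (by simp [Finset.card_eq_zero.1 hS])
        have : cnt X ≤ cnt (fun i => P (Sum.inl (blobZero.base i)) (c + 0)) :=
          cnt_mono (fun i _ => hP)
        omega
      · omega
    · omega
  · have : cnt X = 0 := by
      classical
      unfold cnt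
      rw [Finset.card_eq_zero, Finset.filter_eq_empty_iff]
      intro i _
      have : i = 0 := Subsingleton.elim (α := Fin 1) _ _
      rwa [this]
    omega

lemma Q_succ (F : ConnFam) (hF : IsConnectorFam F) {n : ℕ} (b : Blob n) (hQ : QProp b) :
    QProp (blobSucc F n b) := by
  intro S P hc c X hX g
  change Finset ((b.GV ⊕ (F.V n ⊕ (b.GV ⊕ b.AV))) ⊕ (b.AV ⊕ F.V n)) at S
  change (b.GV ⊕ (F.V n ⊕ (b.GV ⊕ b.AV))) ⊕ (b.AV ⊕ F.V n) → ℕ → Prop at P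
  have hcG : Closed (blobSucc F n b).EG S.toLeft (fun v => P (Sum.inl v)) := by
    refine ⟨fun v d h => hc.1 _ _ h,
      fun v w d h he hw => hc.2 _ _ _ h (Or.inl ⟨v, w, rfl, rfl, he⟩) ?_⟩
    exact fun h' => hw (Finset.mem_toLeft.2 h')
  obtain ⟨p, q, hpq, hp, hcore⟩ := core F hF b hQ S.toLeft (fun v => P (Sum.inl v)) hcG
  obtain ⟨A, T, hcard, hAT⟩ := conn F hF n S.toRight.toRight
  have hA : A.card ≤ 2 ^ n := (Finset.card_le_univ _).trans (by simp)
  have hT : T.card ≤ 2 ^ n := (Finset.card_le_univ _).trans (by simp)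
  let SL : Finset (b.GV ⊕ b.AV) := S.toLeft.toLeft.disjSum S.toRight.toLeft
  have hSL : ∀ v, emb F b v ∈ S ↔ v ∈ SL := by
    intro v
    cases v <;> simp [emb, SL]
  have hSLc : SL.card = S.toLeft.toLeft.card + S.toRight.toLeft.card :=
    Finset.card_disjSum _ _
  have hcL : Closed b.E SL (fun v => P (emb F b v)) := by
    refine ⟨fun v d h => hc.1 _ _ h, fun v w d h he hw =>
      hc.2 _ _ _ h (Or.inr (Or.inl ⟨v, w, ?_, ?_, he⟩)) ?_⟩
    · cases v <;> rfl
    · cases w <;> rfl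
    · exact fun h' => hw ((hSL w).1 h')
  have hcH : Closed (F.E n) S.toRight.toRight (fun v => P (Sum.inr (Sum.inr v))) := by
    refine ⟨fun v d h => hc.1 _ _ h, fun v w d h he hw =>
      hc.2 _ _ _ h (Or.inr (Or.inr (Or.inl ⟨v, w, rfl, rfl, he⟩))) ?_⟩
    exact fun h' => hw (Finset.mem_toRight.2 (Finset.mem_toRight.2 h'))
  have hXs := cnt_split (two_pow_split n) X
  have hBs := cnt_split (two_pow_split n)
    (fun i => P (Sum.inl ((blobSucc F n b).base i)) (c + g))
  simp only [base_left, base_right] at hBs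
  have c1 := card3 S.toLeft
  have c2 := S.toRight.card_toLeft_add_card_toRight
  have c3 := S.card_toLeft_add_card_toRight
  have hk1 := cnt_le (fun i : Fin (2 ^ n) => X ⟨i, by have := two_pow_split n; omega⟩)
  have hk2 := cnt_le (fun i : Fin (2 ^ n) => X ⟨2 ^ n + i, by have := two_pow_split n; omega⟩)
  have hfL : ∀ d, cnt (fun i : Fin (2 ^ n) => X ⟨i, by have := two_pow_split n; omega⟩) ≤
      cnt (fun i => P (Sum.inl (Sum.inl (b.base i))) (c + d)) + SL.card + d := by
    intro d
    refine hQ SL _ hcL c _ ?_ d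
    intro j hj hjS
    have := hX _ hj
    rw [tgt_left] at this
    exact this (fun h' => hjS ((hSL _).1 h'))
  have key := combine
    (fL := fun d => cnt (fun i => P (Sum.inl (Sum.inl (b.base i))) (c + d)))
    (fR := fun d => cnt (fun i => P (Sum.inl (Sum.inr (Sum.inr (Sum.inl (b.base i))))) (c + d)))
    (k1 := cnt (fun i : Fin (2 ^ n) => X ⟨i, by have := two_pow_split n; omega⟩))
    (K := cnt X) (N := 2 ^ n) (sL := SL.card) (sR := S.toLeft.toRight.toRight.card)
    (s := S.card) hpq (by omega) (by omega)
    (fun d e hde => cnt_mono (fun i hi => hc.down (by omega) hi))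
    hfL
    (by
      intro d hd g
      have := hcore (c + d + 1) (lt_of_lt_of_le hd (cnt_mono (by
        intro i hi hS
        refine hcG.2 _ _ _ hi ?_ hS
        exact ⟨i, rfl, rfl⟩))) g
      simpa only [add_assoc] using this)
    (by
      intro hk d
      have hL := hfL d
      by_cases hbad : cnt X ≤ S.card ∨ T.card ≤ p
      · omega
      have hex : 2 ^ n < cnt (fun i : Fin (2 ^ n) => X ⟨2 ^ n + i, by
          have := two_pow_split n; omega⟩) + A.card := by omega
      obtain ⟨i, hi, hiA⟩ := cnt_inter hex
      have hTp : p < T.card := by omega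
      have := hcore c (lt_of_lt_of_le hTp (by
        rw [← cnt_mem T]
        apply cnt_mono
        intro o ho hS
        have hr := hAT i hiA o ho
        have h1 := hX _ hi
        rw [tgt_right] at h1
        have h2 := h1 (fun h' => hr.1 (Finset.mem_toRight.2 (Finset.mem_toRight.2 h')))
        have h3 : P (Sum.inr (Sum.inr (F.out n o))) c := hcH.reach hr h2
        refine hc.1 _ _ (hc.2 _ _ _ h3 (Or.inr (Or.inr (Or.inr ⟨o, rfl, rfl⟩))) ?_)
        exact fun h' => hS (Finset.mem_toLeft.2 h'))) d
      omega) g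
  exact key.trans (le_of_eq (congrArg (fun t => t + S.card + g) hBs.symm))

lemma Q_all (F : ConnFam) (hF : IsConnectorFam F) (n : ℕ) : QProp (blob F n) := by
  induction n with
  | zero => exact Q_zero
  | succ n ih => exact Q_succ F hF _ ih

lemma B_zero : BProp blobZero := by
  intro S P hc h0 g
  by_cases hS : S.card = 0
  · rcases Nat.eq_zero_or_pos g with rfl | hg
    · have : cnt (fun i : Fin (2 ^ 0) => i ∈ (Finset.univ : Finset (Fin (2 ^ 0)))) ≤
          cnt (fun i => P (blobZero.base i) 0) :=
        cnt_mono (fun i _ => h0 _ (by simp [Finset.card_eq_zero.1 hS]))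
      rw [cnt_mem] at this
      simp at this
      simp
      omega
    · simp; omega
  · simp; omega

lemma B_succ (F : ConnFam) (hF : IsConnectorFam F) {n : ℕ} (b : Blob n) (hQ : QProp b)
    (hE : ∀ x y, b.EG x y → b.E (Sum.inl x) (Sum.inl y)) (hB : BProp b) :
    BProp (blobSucc F n b) := by
  intro S P hc h0 g
  change Finset (b.GV ⊕ (F.V n ⊕ (b.GV ⊕ b.AV))) at S
  change b.GV ⊕ (F.V n ⊕ (b.GV ⊕ b.AV)) → ℕ → Prop at P
  obtain ⟨p, q, hpq, hp, hcore⟩ := core F hF b hQ S P hc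
  have hcL : Closed b.EG S.toLeft (fun v => P (Sum.inl v)) := by
    refine ⟨fun v d h => hc.1 _ _ h, fun v w d h he hw => hc.2 _ _ _ h he ?_⟩
    exact fun h' => hw (Finset.mem_toLeft.2 h')
  have hcR : Closed b.EG S.toRight.toRight.toLeft
      (fun v => P (Sum.inr (Sum.inr (Sum.inl v)))) := by
    refine ⟨fun v d h => hc.1 _ _ h, fun v w d h he hw => hc.2 _ _ _ h (hE _ _ he) ?_⟩
    exact fun h' => hw (Finset.mem_toLeft.2 (Finset.mem_toRight.2 (Finset.mem_toRight.2 h')))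
  have hBs := cnt_split (two_pow_split n) (fun i => P ((blobSucc F n b).base i) g)
  simp only [base_left, base_right] at hBs
  have c1 := card3 S
  have c2 := S.toRight.toRight.card_toLeft_add_card_toRight
  have hpow := two_pow_split n
  have key := combine
    (fL := fun d => cnt (fun i => P (Sum.inl (b.base i)) d))
    (fR := fun d => cnt (fun i => P (Sum.inr (Sum.inr (Sum.inl (b.base i)))) d))
    (k1 := 2 ^ n)
    (K := 2 ^ (n + 1)) (N := 2 ^ n) (sL := S.toLeft.card) (sR := S.toRight.toRight.card)
    (s := S.card) hpq (by omega) (by omega)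
    (fun d e hde => cnt_mono (fun i hi => hc.down (by omega) hi))
    (by
      intro d
      exact hB _ _ hcL (fun v hv => h0 _ (fun h' => hv (Finset.mem_toLeft.2 h'))) d)
    (by
      intro d hd g
      exact hcore (d + 1) (lt_of_lt_of_le hd (cnt_mono (by
        intro i hi hS
        refine hc.2 _ _ _ hi ?_ hS
        exact ⟨i, rfl, rfl⟩))) g)
    (by
      intro hk d
      have := hB _ _ hcR (fun v hv => h0 _ (fun h' => hv (Finset.mem_toLeft.2 (Finset.mem_toRight.2 (Finset.mem_toRight.2 h'))))) d
      omega) g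
  exact key.trans (le_of_eq (congrArg (fun t => t + S.card + g) hBs.symm))

lemma B_all (F : ConnFam) (hF : IsConnectorFam F) (n : ℕ) : BProp (blob F n) := by
  induction n with
  | zero => exact B_zero
  | succ n ih =>
    exact B_succ F hF _ (Q_all F hF n) (fun _ _ h => EG_E F n h) ih

lemma base_inj (F : ConnFam) (n : ℕ) : Function.Injective (blob F n).base := by
  induction n with
  | zero => intro i j _; exact Subsingleton.elim (α := Fin 1) _ _
  | succ n ih =>
    intro i j h
    change (blobSucc F n (blob F n)).base i = (blobSucc F n (blob F n)).base j at h
    have hp := two_pow_split n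
    simp only [blobSucc] at h
    split_ifs at h with h1 h2 h2
    · have := ih (Sum.inl.inj h)
      simp only [Fin.mk.injEq] at this
      exact Fin.ext this
    · have := ih (Sum.inl.inj (Sum.inr.inj (Sum.inr.inj h)))
      simp only [Fin.mk.injEq] at this
      exact Fin.ext (by omega)

lemma closed_long {V : Type*} (E : V → V → Prop) (S : Finset V) :
    Closed E S (fun v d => LongPathEndingGe E {x | x ∉ S} v d) := by
  constructor
  · rintro v d ⟨l, h1, h2, h3, h4⟩
    exact ⟨l, h1, h2, h3, by omega⟩
  · rintro v w d ⟨l, h1, h2, h3, h4⟩ he hw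
    refine ⟨l ++ [w], ?_, ?_, by simp, by simpa using h4⟩
    · refine List.isChain_append.2 ⟨h1, by simp, ?_⟩
      intro x hx y hy
      rw [h3] at hx
      simp at hx hy
      subst hx hy
      exact he
    · intro x hx
      simp only [List.mem_append, List.mem_singleton] at hx
      rcases hx with hx | rfl
      · exact h2 x hx
      · exact hw

lemma right_count (F : ConnFam) (hF : IsConnectorFam F) {n : ℕ} (b : Blob n)
    (hQ : QProp b) (hB : BProp b)
    (S : Finset (b.GV ⊕ (F.V n ⊕ (b.GV ⊕ b.AV))))
    (P : b.GV ⊕ (F.V n ⊕ (b.GV ⊕ b.AV)) → ℕ → Prop)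
    (hc : Closed (blobSucc F n b).EG S P) (h0 : ∀ v, v ∉ S → P v 0)
    (s : ℕ) (hs : S.card = s) (hS : s < 2 ^ n) :
    2 ^ n ≤ cnt (fun i : Fin (2 ^ n) => P (Sum.inr (Sum.inr (Sum.inl (b.base i))))
      (2 ^ n)) + s := by
  obtain ⟨p, q, hpq, hp, hcore⟩ := core F hF b hQ S P hc
  have hcL : Closed b.EG S.toLeft (fun v => P (Sum.inl v)) := by
    refine ⟨fun v d h => hc.1 _ _ h, fun v w d h he hw => hc.2 _ _ _ h he ?_⟩
    exact fun h' => hw (Finset.mem_toLeft.2 h')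
  have c1 := card3 S
  have h1 := hB _ _ hcL (fun v hv => h0 _ (fun h' => hv (Finset.mem_toLeft.2 h'))) (2 ^ n - S.toLeft.card - p - 1)
  have h2 := hcore (2 ^ n - S.toLeft.card - p - 1 + 1)
    (lt_of_lt_of_le (by omega :
      p < cnt (fun i => P (Sum.inl (b.base i)) (2 ^ n - S.toLeft.card - p - 1))) (cnt_mono (by
        intro i hi hS
        refine hc.2 _ _ _ hi ?_ hS
        exact ⟨i, rfl, rfl⟩))) (S.toLeft.card + p)
  have e : 2 ^ n - S.toLeft.card - p - 1 + 1 + (S.toLeft.card + p) = 2 ^ n := by omega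
  rw [e] at h2
  omega

/-- Fix a `2^k`-connector `H_k` for each `k ≥ 0`, and let `{G_n}` be
the recursively constructed family of DAGs with base lists `Base(G_n)` of length `2^n`.
Then for every `n`, the graph `G_{n+1}` is `(2^n, 2^n)`-depth-robust with respect to
`Base(RS(G_{n+1}))`, the base list of its right component — which is exactly the second
half of `Base(G_{n+1}) = Base(LS(G_{n+1})) : Base(RS(G_{n+1}))`. -/
theorem stmt12 (F : ConnFam) (hF : IsConnectorFam F) (n : ℕ) :
    DepthRobustSet (blob F (n + 1)).EG
      (Set.range fun i : Fin (2 ^ n) =>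
        (blob F (n + 1)).base ⟨2 ^ n + (i : ℕ), by
          have hi := i.isLt
          have key : (2 : ℕ) ^ (n + 1) = 2 ^ n * 2 := pow_succ 2 n
          omega⟩)
      (2 ^ n) (2 ^ n) := by
  classical
  have hp := two_pow_split n
  have hfinj : Function.Injective (fun i : Fin (2 ^ n) =>
        (blob F (n + 1)).base ⟨2 ^ n + (i : ℕ), by
          have hi := i.isLt
          omega⟩) := by
    intro i j h
    have := base_inj F (n + 1) h
    simp only [Fin.mk.injEq] at this
    exact Fin.ext (by omega)
  refine ⟨?_, ?_⟩
  · rw [← Set.image_univ, Set.ncard_image_of_injective _ hfinj, Set.ncard_univ]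
    simp
  · intro R hR hlt
    have hcl := closed_long (blob F (n + 1)).EG hR.toFinset
    have hset : {x | x ∉ hR.toFinset} = {x | x ∉ R} := by ext; simp
    rw [hset] at hcl
    have hcardR : hR.toFinset.card = R.ncard := (Set.ncard_eq_toFinset_card R hR).symm
    have h0 : ∀ v, v ∉ hR.toFinset →
        LongPathEndingGe (blob F (n + 1)).EG {x | x ∉ R} v 0 := by
      intro v hv
      exact ⟨[v], List.isChain_singleton v, by simpa using hv, by simp, by simp⟩
    have h := right_count F hF (blob F n) (Q_all F hF n) (B_all F hF n) hR.toFinset _ hcl h0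
      R.ncard hcardR hlt
    let W : Finset (Fin (2 ^ n)) := Finset.univ.filter fun i =>
      LongPathEndingGe (blob F (n + 1)).EG {x | x ∉ R}
        ((blob F (n + 1)).base ⟨2 ^ n + (i : ℕ), by have hi := i.isLt; omega⟩) (2 ^ n)
    refine ⟨Set.image (fun i : Fin (2 ^ n) =>
        (blob F (n + 1)).base ⟨2 ^ n + (i : ℕ), by
          have hi := i.isLt
          omega⟩) (W : Set (Fin (2 ^ n))), Set.image_subset_range _ _, ?_, ?_⟩
    · rw [Set.ncard_image_of_injective _ hfinj, Set.ncard_coe_finset]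
      have hW : cnt (fun i => i ∈ W) = W.card := cnt_mem W
      have hle := h.trans (Nat.add_le_add_right (cnt_mono (r := fun i => i ∈ W) (by
        intro i hi
        refine Finset.mem_filter.2 ⟨Finset.mem_univ _, ?_⟩
        have hb := base_right F (blob F n) i (by have := i.isLt; omega)
        change LongPathEndingGe _ _ ((blobSucc F n (blob F n)).base _) _
        rw [hb]
        exact hi)) _)
      omega
    · rintro v ⟨i, hi, rfl⟩
      simpa [W] using hi
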